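/- (Existence for the timelike Björling problem.) Let I ⊆ ℝ be a nonempty open interval, γ : I → ℝ³ real-analytic with ⟨γ'(t), γ'(t)⟩ < 0 for all t ∈ I (a timelike curve), and W : I → ℝ³ real-analytic with ⟨W(t), W(t)⟩ = 1 and ⟨γ'(t), W(t)⟩ = 0 for all t ∈ I. Define X : D(I) → ℝ³ by X(t,s) = ½(γ(t+s) + γ(t−s)) + ½ ∫_{t−s}^{t+s} W(τ) ×ₗ γ'(τ) dτ. Then: (a) X(t,0) = γ(t), ∂X/∂t(t,0) = γ'(t) and ∂X/∂s(t,0) = W(t) ×ₗ γ'(t) for all t ∈ I; (b) on all of D(I): X_tt = X_ss, ⟨X_t, X_s⟩ = 0 and ⟨X_t, X_t⟩ + ⟨X_s, X_s⟩ = 0; (c) there exists an open set U with I×{0} ⊆ U ⊆ D(I) on which ⟨X_t, X_t⟩ < 0, so that X restricted to U is a conformal timelike minimal immersion; (d) X_t(t,0) ×ₗ X_s(t,0) = −⟨γ'(t), γ'(t)⟩ · W(t) for all t ∈ I, i.e. the Gauss map of X along s = 0 equals W. -/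

import Mathlib

/-- Partial derivative in the first (t) coordinate. -/
noncomputable def pdt {E : Type*} [NormedAddCommGroup E] [NormedSpace ℝ E]
    (f : ℝ × ℝ → E) (p : ℝ × ℝ) : E := deriv (fun x => f (x, p.2)) p.1

/-- Partial derivative in the second (s) coordinate. -/
noncomputable def pds {E : Type*} [NormedAddCommGroup E] [NormedSpace ℝ E]
    (f : ℝ × ℝ → E) (p : ℝ × ℝ) : E := deriv (fun y => f (p.1, y)) p.2

/-- The Minkowski inner product on ℝ³ = ℝ × ℝ × ℝ: ⟨x,y⟩ = -x₁y₁ + x₂y₂ + x₃y₃. -/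
def mink (x y : ℝ × ℝ × ℝ) : ℝ := -(x.1 * y.1) + x.2.1 * y.2.1 + x.2.2 * y.2.2

/-- The Lorentzian cross product on ℝ³, characterized by ⟨u ×ₗ v, w⟩ = det[u,v,w]. -/
def lcross (u v : ℝ × ℝ × ℝ) : ℝ × ℝ × ℝ :=
  (-(u.2.1 * v.2.2 - u.2.2 * v.2.1), u.2.2 * v.1 - u.1 * v.2.2, u.1 * v.2.1 - u.2.1 * v.1)

/-- Diamond domain D(I) = {(t,s) : t+s ∈ I and t−s ∈ I}. -/
def diamond (I : Set ℝ) : Set (ℝ × ℝ) := {p | p.1 + p.2 ∈ I ∧ p.1 - p.2 ∈ I}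

theorem isOpen_diamond {I : Set ℝ} (hI : IsOpen I) : IsOpen (diamond I) :=
  (hI.preimage (by fun_prop : Continuous fun p : ℝ × ℝ => p.1 + p.2)).inter
    (hI.preimage (by fun_prop : Continuous fun p : ℝ × ℝ => p.1 - p.2))

theorem mem_diamond_zero {I : Set ℝ} {t : ℝ} (ht : t ∈ I) : (t, (0 : ℝ)) ∈ diamond I := by
  simpa [diamond] using ht

section DAlembert

variable {E : Type*} [NormedAddCommGroup E] [NormedSpace ℝ E] {I : Set ℝ} {f g f' g' : ℝ → E}
  {X : ℝ × ℝ → E}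

/-- The `t`-derivative of a d'Alembert wave `f (t + s) + g (t - s)`. -/
theorem pdt_dAlembert (hI : IsOpen I)
    (hX : ∀ p ∈ diamond I, X p = f (p.1 + p.2) + g (p.1 - p.2))
    (hf : ∀ x ∈ I, HasDerivAt f (f' x) x) (hg : ∀ x ∈ I, HasDerivAt g (g' x) x) :
    ∀ p ∈ diamond I, pdt X p = f' (p.1 + p.2) + g' (p.1 - p.2) := by
  rintro ⟨t, s⟩ hp
  have hev : (fun x => X (x, s)) =ᶠ[nhds t] fun x => f (x + s) + g (x - s) := by
    have hc : ContinuousAt (fun x : ℝ => (x, s)) t := by fun_prop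
    filter_upwards [hc ((isOpen_diamond hI).mem_nhds hp)] with x hx using hX _ hx
  exact (((hf _ hp.1).comp_add_const t s).add
    ((hg _ hp.2).comp_sub_const t s)).congr_of_eventuallyEq hev |>.deriv

/-- The `s`-derivative of a d'Alembert wave `f (t + s) + g (t - s)`. -/
theorem pds_dAlembert (hI : IsOpen I)
    (hX : ∀ p ∈ diamond I, X p = f (p.1 + p.2) + g (p.1 - p.2))
    (hf : ∀ x ∈ I, HasDerivAt f (f' x) x) (hg : ∀ x ∈ I, HasDerivAt g (g' x) x) :
    ∀ p ∈ diamond I, pds X p = f' (p.1 + p.2) - g' (p.1 - p.2) := by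
  rintro ⟨t, s⟩ hp
  have hev : (fun y => X (t, y)) =ᶠ[nhds s] fun y => f (t + y) + g (t - y) := by
    have hc : ContinuousAt (fun y : ℝ => (t, y)) s := by fun_prop
    filter_upwards [hc ((isOpen_diamond hI).mem_nhds hp)] with y hy using hX _ hy
  rw [sub_eq_add_neg]
  exact (((hf _ hp.1).comp_const_add t s).add
    ((hg _ hp.2).comp_const_sub t s)).congr_of_eventuallyEq hev |>.deriv

/-- A d'Alembert wave with twice differentiable profiles solves the wave equation. -/
theorem pdt_pdt_eq_pds_pds_dAlembert (hI : IsOpen I)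
    (hX : ∀ p ∈ diamond I, X p = f (p.1 + p.2) + g (p.1 - p.2))
    (hf : ∀ x ∈ I, HasDerivAt f (f' x) x) (hg : ∀ x ∈ I, HasDerivAt g (g' x) x)
    (hf' : ∀ x ∈ I, DifferentiableAt ℝ f' x) (hg' : ∀ x ∈ I, DifferentiableAt ℝ g' x) :
    ∀ p ∈ diamond I, pdt (pdt X) p = pds (pds X) p := by
  intro p hp
  rw [pdt_dAlembert hI (pdt_dAlembert hI hX hf hg) (fun x hx => (hf' x hx).hasDerivAt)
      (fun x hx => (hg' x hx).hasDerivAt) p hp,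
    pds_dAlembert (g := fun x => -g' x) (g' := fun x => -deriv g' x) hI
      (fun q hq => by rw [pds_dAlembert hI hX hf hg q hq, sub_eq_add_neg])
      (fun x hx => (hf' x hx).hasDerivAt) (fun x hx => (hg' x hx).hasDerivAt.neg) p hp,
    sub_neg_eq_add]

end DAlembert

/-- The primitive of a continuous function on an open interval, based at a point of it. -/
theorem hasDerivAt_integral_of_continuousOn {E : Type*} [NormedAddCommGroup E] [NormedSpace ℝ E]
    [CompleteSpace E] {I : Set ℝ} (hI : IsOpen I) (hord : I.OrdConnected) {N : ℝ → E}
    (hN : ContinuousOn N I) {c x : ℝ} (hc : c ∈ I) (hx : x ∈ I) :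
    HasDerivAt (fun u => ∫ τ in c..u, N τ) (N x) x :=
  intervalIntegral.integral_hasDerivAt_right
    (hN.mono (hord.uIcc_subset hc hx)).intervalIntegrable
    (hN.stronglyMeasurableAtFilter hI x hx) (hN.continuousAt (hI.mem_nhds hx))

theorem DifferentiableAt.lcross {u v : ℝ → ℝ × ℝ × ℝ} {x : ℝ} (hu : DifferentiableAt ℝ u x)
    (hv : DifferentiableAt ℝ v x) : DifferentiableAt ℝ (fun τ => lcross (u τ) (v τ)) x := by
  unfold _root_.lcross
  fun_prop

theorem continuous_mink_self : Continuous fun x : ℝ × ℝ × ℝ => mink x x := by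
  unfold mink
  fun_prop

theorem mink_lcross_right (u v : ℝ × ℝ × ℝ) : mink v (lcross u v) = 0 := by
  simp only [mink, lcross]
  ring

/-- The Lorentzian Lagrange identity. -/
theorem mink_lcross_self (u v : ℝ × ℝ × ℝ) :
    mink (lcross u v) (lcross u v) = mink v u ^ 2 - mink u u * mink v v := by
  simp only [mink, lcross]
  ring

theorem lcross_lcross (u v : ℝ × ℝ × ℝ) :
    lcross v (lcross u v) = mink v u • v - mink v v • u := by
  ext <;> simp [mink, lcross] <;> ring

theorem mink_half_add_self (v w : ℝ × ℝ × ℝ) :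
    mink ((1 / 2 : ℝ) • (v + w)) ((1 / 2 : ℝ) • (v + w)) =
      (mink v v + 2 * mink v w + mink w w) / 4 := by
  simp [mink]
  ring

theorem mink_half_sub_self (v w : ℝ × ℝ × ℝ) :
    mink ((1 / 2 : ℝ) • (v - w)) ((1 / 2 : ℝ) • (v - w)) =
      (mink v v - 2 * mink v w + mink w w) / 4 := by
  simp [mink]
  ring

theorem mink_add_sub (p q : ℝ × ℝ × ℝ) : mink (p + q) (p - q) = mink p p - mink q q := by
  simp [mink]
  ring

theorem mink_add_self_add_mink_sub_self (p q : ℝ × ℝ × ℝ) :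
    mink (p + q) (p + q) + mink (p - q) (p - q) = 2 * (mink p p + mink q q) := by
  simp [mink]
  ring

/-- Existence for the timelike Björling problem: given a real-analytic timelike curve γ
and real-analytic unit spacelike normal field W along it, the Björling formula produces a
conformal timelike minimal immersion with X(t,0) = γ(t) and Gauss map W along s = 0. -/
theorem stmt11 (I : Set ℝ) (hI : IsOpen I) (hne : I.Nonempty) (hord : I.OrdConnected)
    (γ W : ℝ → ℝ × ℝ × ℝ) (hγ : AnalyticOnNhd ℝ γ I) (hW : AnalyticOnNhd ℝ W I)
    (htime : ∀ t ∈ I, mink (deriv γ t) (deriv γ t) < 0)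
    (hWunit : ∀ t ∈ I, mink (W t) (W t) = 1)
    (horth : ∀ t ∈ I, mink (deriv γ t) (W t) = 0)
    (X : ℝ × ℝ → ℝ × ℝ × ℝ)
    (hXdef : ∀ p : ℝ × ℝ, X p = (1 / 2 : ℝ) • (γ (p.1 + p.2) + γ (p.1 - p.2)) +
        (1 / 2 : ℝ) • ∫ τ in (p.1 - p.2)..(p.1 + p.2), lcross (W τ) (deriv γ τ)) :
    (∀ t ∈ I, X (t, 0) = γ t ∧ pdt X (t, 0) = deriv γ t ∧
        pds X (t, 0) = lcross (W t) (deriv γ t)) ∧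
    (∀ p ∈ diamond I, pdt (pdt X) p = pds (pds X) p ∧
        mink (pdt X p) (pds X p) = 0 ∧
        mink (pdt X p) (pdt X p) + mink (pds X p) (pds X p) = 0) ∧
    (∃ U : Set (ℝ × ℝ), IsOpen U ∧ (∀ t ∈ I, (t, (0 : ℝ)) ∈ U) ∧ U ⊆ diamond I ∧
        ∀ p ∈ U, mink (pdt X p) (pdt X p) < 0) ∧
    (∀ t ∈ I, lcross (pdt X (t, 0)) (pds X (t, 0)) =
        (-(mink (deriv γ t) (deriv γ t))) • W t) := by
  set N : ℝ → ℝ × ℝ × ℝ := fun τ => lcross (W τ) (deriv γ τ) with hN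
  have hVd : ∀ x ∈ I, DifferentiableAt ℝ (deriv γ) x := fun x hx => (hγ.deriv x hx).differentiableAt
  have hNd : ∀ x ∈ I, DifferentiableAt ℝ N x := fun x hx =>
    (hW x hx).differentiableAt.lcross (hVd x hx)
  have hNc : ContinuousOn N I := fun x hx => (hNd x hx).continuousAt.continuousWithinAt
  obtain ⟨c, hc⟩ := hne
  have hX : ∀ p ∈ diamond I, X p =
      (fun x => (1 / 2 : ℝ) • (γ x + ∫ τ in c..x, N τ)) (p.1 + p.2) +
      (fun x => (1 / 2 : ℝ) • (γ x - ∫ τ in c..x, N τ)) (p.1 - p.2) := by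
    intro p hp
    have hint : ∀ x ∈ I, IntervalIntegrable N MeasureTheory.volume c x := fun x hx =>
      (hNc.mono (hord.uIcc_subset hc hx)).intervalIntegrable
    rw [hXdef, ← intervalIntegral.integral_interval_sub_left (hint _ hp.1) (hint _ hp.2)]
    module
  have hf : ∀ x ∈ I, HasDerivAt (fun x => (1 / 2 : ℝ) • (γ x + ∫ τ in c..x, N τ))
      ((fun x => (1 / 2 : ℝ) • (deriv γ x + N x)) x) x := fun x hx =>
    ((hγ x hx).differentiableAt.hasDerivAt.fun_add
      (hasDerivAt_integral_of_continuousOn hI hord hNc hc hx)).fun_const_smul (1 / 2 : ℝ)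
  have hg : ∀ x ∈ I, HasDerivAt (fun x => (1 / 2 : ℝ) • (γ x - ∫ τ in c..x, N τ))
      ((fun x => (1 / 2 : ℝ) • (deriv γ x - N x)) x) x := fun x hx =>
    ((hγ x hx).differentiableAt.hasDerivAt.fun_sub
      (hasDerivAt_integral_of_continuousOn hI hord hNc hc hx)).fun_const_smul (1 / 2 : ℝ)
  have ht := pdt_dAlembert hI hX hf hg
  have hs := pds_dAlembert hI hX hf hg
  have hNN : ∀ x ∈ I, mink (N x) (N x) = -mink (deriv γ x) (deriv γ x) := fun x hx => by
    rw [hN, mink_lcross_self, horth x hx, hWunit x hx]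
    ring
  have hP : ∀ x ∈ I, mink ((1 / 2 : ℝ) • (deriv γ x + N x)) ((1 / 2 : ℝ) • (deriv γ x + N x)) = 0 :=
    fun x hx => by
      rw [mink_half_add_self, hNN x hx, mink_lcross_right]
      ring
  have hQ : ∀ x ∈ I, mink ((1 / 2 : ℝ) • (deriv γ x - N x)) ((1 / 2 : ℝ) • (deriv γ x - N x)) = 0 :=
    fun x hx => by
      rw [mink_half_sub_self, hNN x hx, mink_lcross_right]
      ring
  have ht0 : ∀ t ∈ I, pdt X (t, 0) = deriv γ t := fun t hmem => by
    rw [ht _ (mem_diamond_zero hmem)]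
    simp only [add_zero, sub_zero]
    module
  have hs0 : ∀ t ∈ I, pds X (t, 0) = N t := fun t hmem => by
    rw [hs _ (mem_diamond_zero hmem)]
    simp only [add_zero, sub_zero]
    module
  refine ⟨fun t hmem => ⟨?_, ht0 t hmem, hs0 t hmem⟩, fun p hp => ⟨?_, ?_, ?_⟩, ?_, fun t hmem => ?_⟩
  · rw [hX _ (mem_diamond_zero hmem)]
    simp only [add_zero, sub_zero]
    module
  · exact pdt_pdt_eq_pds_pds_dAlembert hI hX hf hg
      (fun x hx => ((hVd x hx).fun_add (hNd x hx)).fun_const_smul (1 / 2 : ℝ))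
      (fun x hx => ((hVd x hx).fun_sub (hNd x hx)).fun_const_smul (1 / 2 : ℝ)) p hp
  · rw [ht p hp, hs p hp, mink_add_sub, hP _ hp.1, hQ _ hp.2, sub_zero]
  · rw [ht p hp, hs p hp, mink_add_self_add_mink_sub_self, hP _ hp.1, hQ _ hp.2]
    simp
  · have hVc : ContinuousOn (deriv γ) I := fun x hx => (hVd x hx).continuousAt.continuousWithinAt
    have hcont : ContinuousOn (pdt X) (diamond I) := by
      refine ContinuousOn.congr (.add ?_ ?_) ht
      · exact ((hVc.add hNc).const_smul (1 / 2 : ℝ)).comp (by fun_prop) fun p hp => hp.1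
      · exact ((hVc.sub hNc).const_smul (1 / 2 : ℝ)).comp (by fun_prop) fun p hp => hp.2
    refine ⟨_, (continuous_mink_self.comp_continuousOn hcont).isOpen_inter_preimage
      (isOpen_diamond hI) isOpen_Iio, fun t hmem => ⟨mem_diamond_zero hmem, ?_⟩,
      Set.inter_subset_left, fun p hp => hp.2⟩
    simpa [ht0 t hmem] using htime t hmem
  · rw [ht0 t hmem, hs0 t hmem, hN, lcross_lcross, horth t hmem]
    simp
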